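/- Let q ∈ (1,2). There exist constants C > 0 and γ > 0, depending only on N, s and q, such that for every open set Ω ⊆ ℝ^N with λ₁(Ω,s,q) > 0 for which the embedding 𝒦(Ω) ↪ L^q(Ω) is compact, and every Lane–Emden density w of Ω, one has w ∈ L^∞(Ω) and ‖w‖_{L^∞(Ω)} ≤ C · λ₁(Ω,s,q)^{−γ}. -/

import Mathlib

open MeasureTheory Filter Topology
open scoped ENNReal RealInnerProductSpace

noncomputable section

abbrev Euc (N : ℕ) := EuclideanSpace ℝ (Fin N)

/-- Gagliardo energy `[u]_s²`. -/
def gagliardo (N : ℕ) (s : ℝ) (u : Euc N → ℝ) : ℝ≥0∞ :=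
  ∫⁻ x : Euc N, ∫⁻ y : Euc N, ENNReal.ofReal ((u x - u y) ^ 2 / ‖x - y‖ ^ ((N : ℝ) + 2 * s))

/-- membership in the concrete model of `𝒟^{s,2}_0(Ω)`. -/
def memK (N : ℕ) (s : ℝ) (Ω : Set (Euc N)) (u : Euc N → ℝ) : Prop :=
  Measurable u ∧ (∀ᵐ x : Euc N ∂volume, x ∉ Ω → u x = 0) ∧ gagliardo N s u < ⊤

/-- first `q`-semilinear `s`-eigenvalue. -/
def lambda1 (N : ℕ) (s q : ℝ) (Ω : Set (Euc N)) : ℝ≥0∞ :=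
  ⨅ u ∈ {u : Euc N → ℝ | memK N s Ω u ∧ (∫ x in Ω, |u x| ^ q) = 1}, gagliardo N s u

/-- nonlocal bilinear form. -/
def dform (N : ℕ) (s : ℝ) (u φ : Euc N → ℝ) : ℝ :=
  ∫ p : Euc N × Euc N, (u p.1 - u p.2) * (φ p.1 - φ p.2) / ‖p.1 - p.2‖ ^ ((N : ℝ) + 2 * s)

/-- compactness of the embedding `𝒦(Ω) ↪ L^q(Ω)`. -/
def compactEmbed (N : ℕ) (s q : ℝ) (Ω : Set (Euc N)) : Prop :=
  ∀ u : ℕ → Euc N → ℝ, (∀ n, memK N s Ω (u n)) →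
    (∃ C : ℝ≥0∞, C < ⊤ ∧ ∀ n, gagliardo N s (u n) ≤ C) →
    ∃ (σ : ℕ → ℕ) (v : Euc N → ℝ), StrictMono σ ∧
      Tendsto (fun k => ∫ x in Ω, |u (σ k) x - v x| ^ q) atTop (𝓝 0)

/-- `q`-semilinear `s`-eigenfunction with eigenvalue `lam`. -/
def isEigenfunction (N : ℕ) (s q : ℝ) (Ω : Set (Euc N)) (lam : ℝ) (u : Euc N → ℝ) : Prop :=
  memK N s Ω u ∧ 0 < ∫ x in Ω, |u x| ^ q ∧
  ∀ φ : Euc N → ℝ, memK N s Ω φ →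
    dform N s u φ
      = lam * (∫ x in Ω, |u x| ^ q) ^ ((2 - q) / q) * ∫ x in Ω, |u x| ^ (q - 2) * u x * φ x

/-- `q`-semilinear `s`-eigenvalue. -/
def isEigenvalue (N : ℕ) (s q : ℝ) (Ω : Set (Euc N)) (lam : ℝ) : Prop :=
  0 < lam ∧ ∃ u : Euc N → ℝ, isEigenfunction N s q Ω lam u

/-- free energy functional `J_Ω`. -/
def freeEnergy (N : ℕ) (s q : ℝ) (Ω : Set (Euc N)) (φ : Euc N → ℝ) : ℝ :=
  (1 / 2) * (gagliardo N s φ).toReal - (1 / q) * ∫ x in Ω, φ x ^ q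

/-- Lane–Emden density of `Ω`: minimizer of the free energy among nonnegative members of `𝒦(Ω)`. -/
def isLaneEmden (N : ℕ) (s q : ℝ) (Ω : Set (Euc N)) (w : Euc N → ℝ) : Prop :=
  memK N s Ω w ∧ (∀ᵐ x : Euc N ∂volume, 0 ≤ w x) ∧
  ∀ φ : Euc N → ℝ, memK N s Ω φ → (∀ᵐ x : Euc N ∂volume, 0 ≤ φ x) →
    freeEnergy N s q Ω w ≤ freeEnergy N s q Ω φ

/-- weak solution of the fractional Lane–Emden equation in `Ω`. -/
def isWeakSolutionLE (N : ℕ) (s q : ℝ) (Ω : Set (Euc N)) (u : Euc N → ℝ) : Prop :=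
  memK N s Ω u ∧ ∀ φ : Euc N → ℝ, memK N s Ω φ →
    dform N s u φ = ∫ x in Ω, |u x| ^ (q - 2) * u x * φ x

/-- nonlocal tail. -/
def nlTail (N : ℕ) (s : ℝ) (w : Euc N → ℝ) (x₀ : Euc N) (ρ : ℝ) : ℝ :=
  ρ ^ (2 * s) * ∫ x in (Metric.ball x₀ ρ)ᶜ, |w x| / ‖x - x₀‖ ^ ((N : ℝ) + 2 * s)

section Gagliardo

variable {N : ℕ} {s q : ℝ}

lemma gagliardo_const_mul (t : ℝ) (u : Euc N → ℝ) :
    gagliardo N s (fun x => t * u x) = ENNReal.ofReal (t ^ 2) * gagliardo N s u := by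
  unfold gagliardo
  rw [← lintegral_const_mul' _ _ ENNReal.ofReal_ne_top]
  congr 1; ext x
  rw [← lintegral_const_mul' _ _ ENNReal.ofReal_ne_top]
  congr 1; ext y
  rw [← ENNReal.ofReal_mul (sq_nonneg t)]
  congr 1
  ring

lemma memK.const_mul {Ω : Set (Euc N)} {u : Euc N → ℝ} (hu : memK N s Ω u) (t : ℝ) :
    memK N s Ω (fun x => t * u x) := by
  refine ⟨hu.1.const_mul t, ?_, ?_⟩
  · filter_upwards [hu.2.1] with x hx hxΩ
    simp [hx hxΩ]
  · rw [gagliardo_const_mul]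
    exact ENNReal.mul_lt_top ENNReal.ofReal_lt_top hu.2.2

lemma sq_sub_min_add_le {a b k : ℝ} (hk : 0 < k) :
    (min a k - min b k) ^ 2 + (if b ≤ k / 2 then max (a - k) 0 * a else 0) ≤ (a - b) ^ 2 := by
  have h1 : (min a k - min b k) ^ 2 ≤ (a - b) ^ 2 :=
    sq_le_sq.2 (by simpa using abs_min_sub_min_le_max a k b k)
  split_ifs with hb
  · rcases le_or_gt a k with ha | ha
    · simpa [max_eq_right (sub_nonpos.2 ha)] using h1
    · rw [max_eq_left (by linarith), min_eq_right ha.le, min_eq_left (by linarith)]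
      nlinarith
  · simpa using h1

lemma rpow_sub_rpow_min_le {a k : ℝ} (hq : q ∈ Set.Ioo (1 : ℝ) 2) (hk : 0 < k) :
    a ^ q - (min a k) ^ q ≤ q * k ^ (q - 2) * (max (a - k) 0 * a) := by
  rcases le_or_gt a k with ha | ha
  · simp [max_eq_right (sub_nonpos.2 ha), min_eq_left ha]
  · rw [max_eq_left (by linarith), min_eq_right ha.le]
    have ha0 : 0 < a := hk.trans ha
    have h1 : 1 + q * (k / a - 1) ≤ (k / a) ^ q := by
      have := one_add_mul_self_le_rpow_one_add (s := k / a - 1)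
        (by have : 0 < k / a := by positivity
            linarith) hq.1.le
      simpa using this
    rw [Real.div_rpow hk.le ha0.le, le_div_iff₀ (by positivity)] at h1
    have h2 : a ^ q = a ^ (q - 2) * a * a := by
      have h3 : q = (q - 2) + 1 + 1 := by ring
      conv_lhs => rw [h3]
      rw [Real.rpow_add_one ha0.ne', Real.rpow_add_one ha0.ne']
    have h4 : (1 + q * (k / a - 1)) * a ^ q = a ^ q - q * (a ^ (q - 2) * ((a - k) * a)) := by
      rw [h2]; field_simp; ring
    have h5 : a ^ (q - 2) ≤ k ^ (q - 2) :=
      Real.rpow_le_rpow_of_nonpos hk ha.le (by linarith [hq.2])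
    have h6 : a ^ (q - 2) * ((a - k) * a) ≤ k ^ (q - 2) * ((a - k) * a) :=
      mul_le_mul_of_nonneg_right h5 (mul_nonneg (by linarith) ha0.le)
    nlinarith [hq.1]

/-- The kernel `|x - y|^{-N-2s}` has large mass on the complement of a set of small measure. -/
lemma le_lintegral_kernel (hN : 1 ≤ N) (hs : 0 < s) {S : Set (Euc N)} (hS : MeasurableSet S)
    {R : ℝ} (hR : 0 < R)
    (hSc : volume Sᶜ ≤ ENNReal.ofReal ((volume (Metric.ball (0 : Euc N) 1)).toReal / 2 * R ^ N))
    (x : Euc N) :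
    ENNReal.ofReal ((volume (Metric.ball (0 : Euc N) 1)).toReal / 2 * R ^ (-(2 * s))) ≤
      ∫⁻ y in S, ENNReal.ofReal (1 / ‖x - y‖ ^ ((N : ℝ) + 2 * s)) := by
  set ω := (volume (Metric.ball (0 : Euc N) 1)).toReal with hω
  have hω0 : 0 ≤ ω := ENNReal.toReal_nonneg
  have : Nonempty (Fin N) := ⟨⟨0, hN⟩⟩
  have : Nontrivial (Euc N) := inferInstance
  have hball : volume (Metric.ball x R) = ENNReal.ofReal (ω * R ^ N) := by
    rw [Measure.addHaar_ball _ _ hR.le, finrank_euclideanSpace_fin, mul_comm ω,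
      ENNReal.ofReal_mul (by positivity), hω, ENNReal.ofReal_toReal measure_ball_lt_top.ne]
  set T := (Metric.ball x R \ Sᶜ) \ {x} with hT
  have hTS : T ⊆ S := fun y hy => by simpa using hy.1.2
  have hTm : MeasurableSet T :=
    (measurableSet_ball.diff hS.compl).diff (measurableSet_singleton x)
  have hvol : ENNReal.ofReal (ω / 2 * R ^ N) ≤ volume T := by
    rw [hT, measure_sdiff_null (measure_singleton x)]
    refine le_trans ?_ le_measure_sdiff
    rw [hball]
    refine le_trans ?_ (tsub_le_tsub_left hSc _)
    rw [← ENNReal.ofReal_sub _ (by positivity)]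
    apply ENNReal.ofReal_le_ofReal
    linarith
  have hexp : 0 < (N : ℝ) + 2 * s := by positivity
  calc ENNReal.ofReal (ω / 2 * R ^ (-(2 * s)))
      = ENNReal.ofReal (1 / R ^ ((N : ℝ) + 2 * s)) * ENNReal.ofReal (ω / 2 * R ^ N) := by
        rw [← ENNReal.ofReal_mul (by positivity)]
        congr 1
        rw [Real.rpow_add hR, Real.rpow_natCast, Real.rpow_neg hR.le]
        field_simp
    _ ≤ ENNReal.ofReal (1 / R ^ ((N : ℝ) + 2 * s)) * volume T := by gcongr
    _ = ∫⁻ _ in T, ENNReal.ofReal (1 / R ^ ((N : ℝ) + 2 * s)) := by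
        rw [setLIntegral_const]
    _ ≤ ∫⁻ y in T, ENNReal.ofReal (1 / ‖x - y‖ ^ ((N : ℝ) + 2 * s)) := by
        refine setLIntegral_mono' hTm fun y hy => ENNReal.ofReal_le_ofReal ?_
        have hxy : 0 < ‖x - y‖ := norm_pos_iff.2 (sub_ne_zero.2 fun h => hy.2 (by simp [h]))
        have hle : ‖x - y‖ ≤ R := by
          have := hy.1.1
          rw [Metric.mem_ball, dist_comm, dist_eq_norm] at this
          exact this.le
        exact one_div_le_one_div_of_le (by positivity)
          (Real.rpow_le_rpow hxy.le hle hexp.le)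
    _ ≤ _ := lintegral_mono_set hTS

/-- Truncating a function whose superlevel set is small decreases its energy quantitatively. -/
lemma gagliardo_min_add_le (hN : 1 ≤ N) (hs : 0 < s) {w : Euc N → ℝ} (hw : Measurable w)
    {k R : ℝ} (hk : 0 < k) (hR : 0 < R)
    (hV : volume {x | k / 2 < w x} ≤
      ENNReal.ofReal ((volume (Metric.ball (0 : Euc N) 1)).toReal / 2 * R ^ N)) :
    gagliardo N s (fun x => min (w x) k) +
      ENNReal.ofReal ((volume (Metric.ball (0 : Euc N) 1)).toReal / 2 * R ^ (-(2 * s))) *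
        ∫⁻ x, ENNReal.ofReal (max (w x - k) 0 * w x) ≤ gagliardo N s w := by
  set c := ENNReal.ofReal ((volume (Metric.ball (0 : Euc N) 1)).toReal / 2 * R ^ (-(2 * s)))
  set S : Set (Euc N) := {x | w x ≤ k / 2}
  have hS : MeasurableSet S := measurableSet_le hw measurable_const
  have hSc : Sᶜ = {x | k / 2 < w x} := by ext; simp [S]
  unfold gagliardo
  have hmeas : Measurable fun x => c * ENNReal.ofReal (max (w x - k) 0 * w x) := by fun_prop
  rw [← lintegral_const_mul' _ _ ENNReal.ofReal_ne_top, ← lintegral_add_right _ hmeas]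
  refine lintegral_mono fun x => ?_
  have h1 : c * ENNReal.ofReal (max (w x - k) 0 * w x) ≤
      ∫⁻ y, S.indicator (fun y => ENNReal.ofReal (max (w x - k) 0 * w x) *
        ENNReal.ofReal (1 / ‖x - y‖ ^ ((N : ℝ) + 2 * s))) y := by
    rw [lintegral_indicator hS, lintegral_const_mul' _ _ ENNReal.ofReal_ne_top, mul_comm]
    gcongr
    exact le_lintegral_kernel hN hs hS hR (hSc ▸ hV) x
  refine (add_le_add_right h1 _).trans ?_
  rw [← lintegral_add_right _ (Measurable.indicator (by fun_prop) hS)]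
  refine lintegral_mono fun y => ?_
  have h2 := sq_sub_min_add_le (a := w x) (b := w y) hk
  have hF : 0 ≤ max (w x - k) 0 * w x := by
    rcases le_or_gt (w x) k with h | h
    · simp [max_eq_right (sub_nonpos.2 h)]
    · exact mul_nonneg (le_max_right _ _) (hk.trans h).le
  have hind : S.indicator (fun y => ENNReal.ofReal (max (w x - k) 0 * w x) *
        ENNReal.ofReal (1 / ‖x - y‖ ^ ((N : ℝ) + 2 * s))) y =
      ENNReal.ofReal ((if w y ≤ k / 2 then max (w x - k) 0 * w x else 0) /
        ‖x - y‖ ^ ((N : ℝ) + 2 * s)) := by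
    by_cases hy : w y ≤ k / 2
    · rw [Set.indicator_of_mem (show y ∈ S from hy), ← ENNReal.ofReal_mul hF, if_pos hy]
      congr 1; ring
    · rw [Set.indicator_of_notMem (show y ∉ S from hy), if_neg hy]
      simp
  rw [hind, ← ENNReal.ofReal_add (by positivity) (by split_ifs <;> positivity), ← add_div]
  exact ENNReal.ofReal_le_ofReal (by gcongr)

lemma lintegral_min_sq_div_norm_rpow_lt_top (hN : 1 ≤ N) (hs : s ∈ Set.Ioo (0 : ℝ) 1) (r : ℝ) :
    ∫⁻ z : Euc N, ENNReal.ofReal (min (‖z‖ ^ 2) (r ^ 2) / ‖z‖ ^ ((N : ℝ) + 2 * s)) < ⊤ := by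
  have : Nonempty (Fin N) := ⟨⟨0, hN⟩⟩
  have : Nontrivial (Euc N) := inferInstance
  have hwint : Integrable
      (fun z : Euc N => min (‖z‖ ^ 2) (r ^ 2) / ‖z‖ ^ ((N : ℝ) + 2 * s)) := by
    rw [integrable_fun_norm_addHaar volume
      (f := fun t : ℝ => min (t ^ 2) (r ^ 2) / t ^ ((N : ℝ) + 2 * s)), finrank_euclideanSpace_fin]
    rw [← Set.Ioc_union_Ioi_eq_Ioi (zero_le_one' ℝ)]
    have key : ∀ t : ℝ, 0 < t → ∀ m : ℝ, t ^ (N - 1) • (m / t ^ ((N : ℝ) + 2 * s)) =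
        m * t ^ (-1 - 2 * s) := by
      intro t ht m
      rw [← Real.rpow_natCast, Nat.cast_sub hN, smul_eq_mul, div_eq_mul_inv,
        ← Real.rpow_neg ht.le, mul_left_comm, ← Real.rpow_add ht]
      congr 2
      push_cast
      ring
    have hmeas : Measurable fun t : ℝ =>
        t ^ (N - 1) • (min (t ^ 2) (r ^ 2) / t ^ ((N : ℝ) + 2 * s)) := by fun_prop
    refine IntegrableOn.union ?_ ?_
    · have h1 : IntegrableOn (fun t : ℝ => t ^ (1 - 2 * s)) (Set.Ioc 0 1) := by
        rw [← intervalIntegrable_iff_integrableOn_Ioc_of_le zero_le_one]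
        exact intervalIntegral.intervalIntegrable_rpow' (by linarith [hs.2])
      refine Integrable.mono' h1 hmeas.aestronglyMeasurable ?_
      refine (ae_restrict_iff' measurableSet_Ioc).2 (Eventually.of_forall fun t ht => ?_)
      have ht0 := ht.1
      rw [key t ht0, Real.norm_of_nonneg (by positivity)]
      calc min (t ^ 2) (r ^ 2) * t ^ (-1 - 2 * s) ≤ t ^ 2 * t ^ (-1 - 2 * s) := by
            gcongr; exact min_le_left _ _
        _ = t ^ (1 - 2 * s) := by
            rw [← Real.rpow_natCast, ← Real.rpow_add ht0]; congr 1; push_cast; ring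
    · have h1 : IntegrableOn (fun t : ℝ => r ^ 2 * t ^ (-1 - 2 * s)) (Set.Ioi 1) :=
        (integrableOn_Ioi_rpow_of_lt (by linarith [hs.1]) one_pos).const_mul _
      refine Integrable.mono' h1 hmeas.aestronglyMeasurable ?_
      refine (ae_restrict_iff' measurableSet_Ioi).2 (Eventually.of_forall fun t ht => ?_)
      have ht0 : 0 < t := one_pos.trans ht
      rw [key t ht0, Real.norm_of_nonneg (by positivity)]
      gcongr
      exact min_le_right _ _
  exact hwint.lintegral_lt_top

lemma lintegral_lintegral_add_mul_sub {f g : Euc N → ℝ≥0∞} (hf : Measurable f)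
    (hg : Measurable g) :
    ∫⁻ x, ∫⁻ y, (f x * g (x - y) + f y * g (x - y)) = 2 * ((∫⁻ x, f x) * ∫⁻ z, g z) := by
  have h1 : Measurable fun p : Euc N × Euc N => f p.2 * g (p.1 - p.2) := by fun_prop
  have h2 : Measurable fun x => ∫⁻ y, f y * g (x - y) := h1.lintegral_prod_right'
  have h3 : ∀ x, ∫⁻ y, (f x * g (x - y) + f y * g (x - y)) =
      f x * (∫⁻ z, g z) + ∫⁻ y, f y * g (x - y) := fun x => by
    rw [lintegral_add_right _ (by fun_prop), lintegral_const_mul _ (by fun_prop),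
      lintegral_sub_left_eq_self g x]
  have h4 : ∀ y, ∫⁻ x, f y * g (x - y) = f y * ∫⁻ z, g z := fun y => by
    rw [lintegral_const_mul _ (by fun_prop), lintegral_sub_right_eq_self g y]
  simp_rw [h3]
  rw [lintegral_add_right _ h2, lintegral_mul_const _ hf,
    lintegral_lintegral_swap (f := fun x y => f y * g (x - y)) h1.aemeasurable]
  simp_rw [h4]
  rw [lintegral_mul_const _ hf, two_mul]

/-- A cone over a small ball is a nonzero element of `𝒦(Ω)`. -/
lemma exists_memK_integral_pos (hN : 1 ≤ N) (hs : s ∈ Set.Ioo (0 : ℝ) 1) (hq : 0 < q)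
    {Ω : Set (Euc N)} (hΩ : IsOpen Ω) (hne : Ω.Nonempty) :
    ∃ φ : Euc N → ℝ, memK N s Ω φ ∧ (∀ x, 0 ≤ φ x) ∧ 0 < ∫ x in Ω, φ x ^ q := by
  obtain ⟨x₀, hx₀⟩ := hne
  obtain ⟨r, hr, hball⟩ := Metric.isOpen_iff.1 hΩ x₀ hx₀
  set φ : Euc N → ℝ := fun x => max (r - ‖x - x₀‖) 0
  have hcont : Continuous φ := by fun_prop
  have hzero : ∀ x, x ∉ Metric.ball x₀ r → φ x = 0 := fun x hx => by
    rw [Metric.mem_ball, dist_eq_norm, not_lt] at hx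
    exact max_eq_right (by linarith)
  have hnn : ∀ x, 0 ≤ φ x := fun x => le_max_right _ _
  have hler : ∀ x, φ x ≤ r := fun x => max_le (by linarith [norm_nonneg (x - x₀)]) hr.le
  have hlip : ∀ x y, |φ x - φ y| ≤ ‖x - y‖ := fun x y => by
    refine (abs_max_sub_max_le_abs _ _ _).trans ?_
    rw [sub_sub_sub_cancel_left, abs_sub_comm]
    simpa using abs_norm_sub_norm_le (x - x₀) (y - x₀)
  refine ⟨φ, ⟨hcont.measurable, ?_, ?_⟩, hnn, ?_⟩
  · exact Eventually.of_forall fun x hx => hzero x fun h => hx (hball h)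
  · set g : Euc N → ℝ≥0∞ :=
      fun z => ENNReal.ofReal (min (‖z‖ ^ 2) (r ^ 2) / ‖z‖ ^ ((N : ℝ) + 2 * s))
    have hgm : Measurable g := by fun_prop
    set B := Metric.ball x₀ r
    have hB : MeasurableSet B := measurableSet_ball
    have hbound : ∀ x y, ENNReal.ofReal ((φ x - φ y) ^ 2 / ‖x - y‖ ^ ((N : ℝ) + 2 * s)) ≤
        B.indicator 1 x * g (x - y) + B.indicator 1 y * g (x - y) := by
      intro x y
      have h1 : ENNReal.ofReal ((φ x - φ y) ^ 2 / ‖x - y‖ ^ ((N : ℝ) + 2 * s)) ≤ g (x - y) := by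
        refine ENNReal.ofReal_le_ofReal ?_
        gcongr
        refine le_min ?_ ?_
        · exact sq_le_sq.2 (by simpa using hlip x y)
        · refine sq_le_sq.2 ?_
          rw [abs_of_pos hr, abs_le]
          constructor <;> linarith [hnn x, hnn y, hler x, hler y]
      by_cases hx : x ∈ B
      · rw [Set.indicator_of_mem hx]
        exact h1.trans (by simp)
      · by_cases hy : y ∈ B
        · rw [Set.indicator_of_mem hy]
          exact h1.trans (by simp)
        · simp [hzero x hx, hzero y hy]
    have hI : ∫⁻ z, g z < ⊤ := lintegral_min_sq_div_norm_rpow_lt_top hN hs r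
    calc gagliardo N s φ
        ≤ ∫⁻ x, ∫⁻ y, (B.indicator 1 x * g (x - y) + B.indicator 1 y * g (x - y)) :=
          lintegral_mono fun x => lintegral_mono fun y => hbound x y
      _ = 2 * ((∫⁻ x, B.indicator 1 x) * ∫⁻ z, g z) :=
          lintegral_lintegral_add_mul_sub (measurable_one.indicator hB) hgm
      _ < ⊤ := by
          rw [lintegral_indicator_one hB]
          exact ENNReal.mul_lt_top (by simp) (ENNReal.mul_lt_top measure_ball_lt_top hI)
  · have hcq : Continuous fun x => φ x ^ q := hcont.rpow_const fun x => Or.inr hq.le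
    have hsupp : HasCompactSupport fun x => φ x ^ q :=
      HasCompactSupport.intro (isCompact_closedBall x₀ r) fun x hx => by
        rw [hzero x fun h => hx (Metric.ball_subset_closedBall h), Real.zero_rpow hq.ne']
    rw [setIntegral_pos_iff_support_of_nonneg_ae
      (Eventually.of_forall fun x => Real.rpow_nonneg (hnn x) q)
      (hcq.integrable_of_hasCompactSupport hsupp).integrableOn]
    refine (Metric.measure_ball_pos volume x₀ hr).trans_le (measure_mono fun x hx => ⟨?_, hball hx⟩)
    have hx' : 0 < φ x := by
      rw [Metric.mem_ball, dist_eq_norm] at hx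
      exact lt_max_of_lt_left (by linarith)
    exact (Real.rpow_pos_of_pos hx' q).ne'

lemma isLaneEmden.integrableOn_rpow (hN : 1 ≤ N) (hs : s ∈ Set.Ioo (0 : ℝ) 1)
    (hq : q ∈ Set.Ioo (1 : ℝ) 2) {Ω : Set (Euc N)} (hΩ : IsOpen Ω) (hne : Ω.Nonempty)
    {w : Euc N → ℝ} (hw : isLaneEmden N s q Ω w) : IntegrableOn (fun x => w x ^ q) Ω := by
  by_contra hni
  have hq0 : 0 < q := one_pos.trans hq.1
  obtain ⟨φ, hφK, hφ0, hφI⟩ := exists_memK_integral_pos hN hs hq0 hΩ hne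
  set I := ∫ x in Ω, φ x ^ q
  set G := (gagliardo N s φ).toReal
  have htend : Tendsto (fun t : ℝ => t ^ (2 - q) * (G / 2)) (𝓝[>] 0) (𝓝 0) := by
    have h1 : ContinuousAt (fun t : ℝ => t ^ (2 - q) * (G / 2)) 0 :=
      (Real.continuousAt_rpow_const 0 _ (Or.inr (by linarith [hq.2]))).mul continuousAt_const
    have h2 := h1.tendsto
    rw [Real.zero_rpow (by linarith [hq.2]), zero_mul] at h2
    exact h2.mono_left nhdsWithin_le_nhds
  obtain ⟨t, ht1, ht0⟩ :=
    ((htend.eventually_lt_const (show (0 : ℝ) < I / q by positivity)).and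
      self_mem_nhdsWithin).exists
  replace ht0 : 0 < t := ht0
  have hJ := hw.2.2 (fun x => t * φ x) (hφK.const_mul t)
    (Eventually.of_forall fun x => mul_nonneg ht0.le (hφ0 x))
  unfold freeEnergy at hJ
  rw [integral_undef hni, gagliardo_const_mul, ENNReal.toReal_mul,
    ENNReal.toReal_ofReal (sq_nonneg t)] at hJ
  have hpow : ∫ x in Ω, (t * φ x) ^ q = t ^ q * I := by
    rw [← integral_const_mul]
    exact integral_congr_ae (Eventually.of_forall fun x => Real.mul_rpow ht0.le (hφ0 x))
  rw [hpow] at hJ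
  have h3 : t ^ 2 = t ^ q * t ^ (2 - q) := by
    rw [← Real.rpow_natCast, ← Real.rpow_add ht0]; congr 1; push_cast; ring
  have h4 : t ^ q * (t ^ (2 - q) * (G / 2)) < t ^ q * (I / q) :=
    mul_lt_mul_of_pos_left ht1 (by positivity)
  have h5 : 0 ≤ (gagliardo N s w).toReal := ENNReal.toReal_nonneg
  change _ ≤ 1 / 2 * (t ^ 2 * G) - 1 / q * (t ^ q * I) at hJ
  have h6 : 1 / 2 * (t ^ 2 * G) - 1 / q * (t ^ q * I) =
      t ^ q * (t ^ (2 - q) * (G / 2)) - t ^ q * (I / q) := by rw [h3]; ring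
  linarith

/-- A Lane–Emden density lies below any level `k` that is large compared to its `L^q` norm. -/
lemma isLaneEmden.ae_le (hN : 1 ≤ N) (hs : 0 < s) (hq : q ∈ Set.Ioo (1 : ℝ) 2)
    {Ω : Set (Euc N)} (hΩ : MeasurableSet Ω) {w : Euc N → ℝ} (hw : isLaneEmden N s q Ω w)
    (hwint : IntegrableOn (fun x => w x ^ q) Ω) {k R : ℝ} (hk : 0 < k) (hR : 0 < R)
    (hV : (∫ x in Ω, w x ^ q) / (k / 2) ^ q ≤
      (volume (Metric.ball (0 : Euc N) 1)).toReal / 2 * R ^ N)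
    (hkR : 2 * k ^ (q - 2) <
      (volume (Metric.ball (0 : Euc N) 1)).toReal / 2 * R ^ (-(2 * s))) :
    ∀ᵐ x ∂volume, w x ≤ k := by
  set ω := (volume (Metric.ball (0 : Euc N) 1)).toReal
  have hq0 : 0 < q := one_pos.trans hq.1
  obtain ⟨⟨hwm, hwΩ, hwG⟩, hw0, hmin⟩ := hw
  have hV' : volume {x | k / 2 < w x} ≤ ENNReal.ofReal (ω / 2 * R ^ N) := by
    have h1 : volume {x | k / 2 < w x} ≤ (volume.restrict Ω) {x | (k / 2) ^ q ≤ w x ^ q} := by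
      rw [Measure.restrict_apply' hΩ]
      refine measure_mono_ae ?_
      filter_upwards [hwΩ] with x hx
      intro (hxk : k / 2 < w x)
      refine ⟨Real.rpow_le_rpow (by positivity) hxk.le hq0.le, ?_⟩
      by_contra hxΩ
      rw [hx hxΩ] at hxk
      linarith
    have h2 := mul_meas_ge_le_integral_of_nonneg (μ := volume.restrict Ω)
      (f := fun x => w x ^ q)
      ((ae_restrict_of_ae hw0).mono fun x hx => Real.rpow_nonneg hx q) hwint ((k / 2) ^ q)
    have hfin : (volume.restrict Ω) {x | (k / 2) ^ q ≤ w x ^ q} ≠ ⊤ :=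
      (hwint.measure_ge_lt_top (by positivity)).ne
    refine h1.trans ?_
    rw [← ENNReal.ofReal_toReal hfin]
    refine ENNReal.ofReal_le_ofReal (le_trans ?_ hV)
    rw [le_div_iff₀ (by positivity), mul_comm]
    exact h2
  have hE := gagliardo_min_add_le hN hs hwm hk hR hV'
  set F : Euc N → ℝ := fun x => max (w x - k) 0 * w x with hF
  have hFm : Measurable F := by fun_prop
  have hF0 : ∀ x, 0 ≤ F x := fun x => by
    rcases le_or_gt (w x) k with h | h
    · simp [hF, max_eq_right (sub_nonpos.2 h)]
    · exact mul_nonneg (le_max_right _ _) (hk.trans h).le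
  have hωR : 0 < ω / 2 * R ^ (-(2 * s)) := lt_trans (by positivity) hkR
  have hAfin : ∫⁻ x, ENNReal.ofReal (F x) < ⊤ := by
    by_contra h
    rw [not_lt_top_iff.1 h, ENNReal.mul_top (by simpa using hωR), add_top] at hE
    exact hwG.not_ge hE
  have hFi : Integrable F := by
    refine ⟨hFm.aestronglyMeasurable, ?_⟩
    rwa [hasFiniteIntegral_iff_ofReal (Eventually.of_forall hF0)]
  have hminK : memK N s Ω (fun x => min (w x) k) := by
    refine ⟨hwm.min measurable_const, ?_, (le_self_add.trans hE).trans_lt hwG⟩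
    filter_upwards [hwΩ] with x hx hxΩ
    rw [hx hxΩ, min_eq_left hk.le]
  have hJ := hmin _ hminK (hw0.mono fun x hx => le_min hx hk.le)
  have hE' : (gagliardo N s (fun x => min (w x) k)).toReal + ω / 2 * R ^ (-(2 * s)) * ∫ x, F x ≤
      (gagliardo N s w).toReal := by
    have := ENNReal.toReal_mono hwG.ne hE
    rwa [ENNReal.toReal_add hminK.2.2.ne (ENNReal.mul_lt_top ENNReal.ofReal_lt_top hAfin).ne,
      ENNReal.toReal_mul, ENNReal.toReal_ofReal hωR.le,
      ← integral_eq_lintegral_of_nonneg_ae (Eventually.of_forall hF0)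
        hFm.aestronglyMeasurable] at this
  have hminint : IntegrableOn (fun x => min (w x) k ^ q) Ω := by
    refine Integrable.mono' hwint ((hwm.min measurable_const).pow_const q).aestronglyMeasurable ?_
    filter_upwards [ae_restrict_of_ae hw0] with x hx
    rw [Real.norm_of_nonneg (Real.rpow_nonneg (le_min hx hk.le) q)]
    exact Real.rpow_le_rpow (le_min hx hk.le) (min_le_left _ _) hq0.le
  have hdiff : (∫ x in Ω, w x ^ q) - ∫ x in Ω, min (w x) k ^ q ≤
      q * k ^ (q - 2) * ∫ x, F x := by
    rw [← integral_sub hwint hminint]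
    calc ∫ x in Ω, (w x ^ q - min (w x) k ^ q) ≤ ∫ x in Ω, q * k ^ (q - 2) * F x :=
          integral_mono (hwint.sub hminint) (hFi.integrableOn.const_mul _)
            fun x => rpow_sub_rpow_min_le hq hk
      _ = q * k ^ (q - 2) * ∫ x in Ω, F x := integral_const_mul _ _
      _ ≤ q * k ^ (q - 2) * ∫ x, F x := by
          gcongr
          · exact Eventually.of_forall hF0
          · exact Measure.restrict_le_self
  have hFzero : ∫ x, F x = 0 := by
    have hI0 : 0 ≤ ∫ x, F x := integral_nonneg hF0
    unfold freeEnergy at hJ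
    have h1 : 1 / q * ((∫ x in Ω, w x ^ q) - ∫ x in Ω, min (w x) k ^ q) ≤
        k ^ (q - 2) * ∫ x, F x := by
      calc _ ≤ 1 / q * (q * k ^ (q - 2) * ∫ x, F x) := by gcongr
        _ = _ := by field_simp
    by_contra hne
    have hIpos : 0 < ∫ x, F x := lt_of_le_of_ne hI0 (Ne.symm hne)
    have := mul_lt_mul_of_pos_right hkR hIpos
    linarith
  filter_upwards [(integral_eq_zero_iff_of_nonneg hF0 hFi).1 hFzero] with x hx
  by_contra hlt
  rw [not_le] at hlt
  have : 0 < F x := mul_pos (lt_max_of_lt_left (by linarith)) (hk.trans hlt)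
  exact this.ne' hx

/-- A priori bound on the `L^q` norm of a Lane–Emden density. -/
lemma isLaneEmden.lambda1_mul_le (hq : 0 < q) {Ω : Set (Euc N)} {w : Euc N → ℝ}
    (hw : isLaneEmden N s q Ω w) (hM : 0 < ∫ x in Ω, w x ^ q) :
    lambda1 N s q Ω ≤
      ENNReal.ofReal (2 / q * (∫ x in Ω, w x ^ q) ^ (-((2 - q) / q))) := by
  set M := ∫ x in Ω, w x ^ q with hMdef
  have hJ := hw.2.2 (fun _ => 0)
    ⟨measurable_const, Eventually.of_forall fun _ _ => rfl, by simp [gagliardo]⟩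
    (Eventually.of_forall fun _ => le_rfl)
  have hG : (gagliardo N s w).toReal ≤ 2 / q * M := by
    have h0 : gagliardo N s (fun _ => 0) = 0 := by simp [gagliardo]
    simp only [freeEnergy, h0, Real.zero_rpow hq.ne', ENNReal.toReal_zero, mul_zero, integral_zero,
      sub_self] at hJ
    rw [← hMdef] at hJ
    have : 2 / q * M = 2 * (1 / q * M) := by ring
    linarith
  set t := M ^ (-(1 / q))
  have ht : 0 < t := by positivity
  have hnorm : ∫ x in Ω, |t * w x| ^ q = 1 := by
    have h1 : ∫ x in Ω, |t * w x| ^ q = ∫ x in Ω, t ^ q * w x ^ q := by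
      refine integral_congr_ae ?_
      filter_upwards [ae_restrict_of_ae hw.2.1] with x hx
      rw [abs_of_nonneg (by positivity), Real.mul_rpow ht.le hx]
    rw [h1, integral_const_mul, ← Real.rpow_mul hM.le, neg_mul, one_div_mul_cancel hq.ne',
      Real.rpow_neg_one, inv_mul_cancel₀ hM.ne']
  calc lambda1 N s q Ω ≤ gagliardo N s (fun x => t * w x) :=
        iInf₂_le (fun x => t * w x) ⟨hw.1.const_mul t, hnorm⟩
    _ = ENNReal.ofReal (t ^ 2) * ENNReal.ofReal (gagliardo N s w).toReal := by
        rw [gagliardo_const_mul, ENNReal.ofReal_toReal hw.1.2.2.ne]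
    _ ≤ ENNReal.ofReal (t ^ 2) * ENNReal.ofReal (2 / q * M) := by gcongr
    _ = _ := by
        rw [← ENNReal.ofReal_mul (sq_nonneg t)]
        congr 1
        have h2 : t ^ 2 * M = M ^ (-((2 - q) / q)) := by
          rw [← Real.rpow_natCast, ← Real.rpow_mul hM.le, ← Real.rpow_add_one hM.ne']
          congr 1
          push_cast
          field_simp
          ring
        rw [← h2]; ring

end Gagliardo

/-- `L^∞` bound for Lane–Emden densities in terms of `λ₁(Ω,s,q)`. -/
theorem stmt_15 (N : ℕ) (hN : 1 ≤ N) (s : ℝ) (hs : s ∈ Set.Ioo (0 : ℝ) 1)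
    (q : ℝ) (hq : q ∈ Set.Ioo (1 : ℝ) 2) :
    ∃ C γ : ℝ, 0 < C ∧ 0 < γ ∧
      ∀ Ω : Set (Euc N), IsOpen Ω → 0 < lambda1 N s q Ω → compactEmbed N s q Ω →
        ∀ w : Euc N → ℝ, isLaneEmden N s q Ω w →
          eLpNorm w ⊤ (volume.restrict Ω) < ⊤ ∧
          eLpNorm w ⊤ (volume.restrict Ω) ≤ ENNReal.ofReal C * lambda1 N s q Ω ^ (-γ) := by
  have hs0 : 0 < s := hs.1
  obtain ⟨hq1, hq2⟩ := id hq
  have hq0 : 0 < q := one_pos.trans hq1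
  set ω := (volume (Metric.ball (0 : Euc N) 1)).toReal with hω
  have hω0 : 0 < ω :=
    ENNReal.toReal_pos (Metric.measure_ball_pos volume _ one_pos).ne' measure_ball_lt_top.ne
  set D := (N : ℝ) * (2 - q) + 2 * s * q
  have hD : 0 < D := by
    have : 0 ≤ (N : ℝ) * (2 - q) := mul_nonneg N.cast_nonneg (by linarith)
    positivity
  set β := 2 * s / D with hβ
  set θ := (2 - q) / D with hθ
  set γ := β * q / (2 - q) with hγ
  have h2q : 0 < 2 - q := by linarith
  have hβ0 : 0 < β := by positivity
  have hγ0 : 0 < γ := by positivity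
  obtain ⟨C, hC0, hC1, hC2⟩ : ∃ C : ℝ, 0 < C ∧ (C / 2) ^ (-q) < ω / 2 ∧
      2 * C ^ (q - 2) < ω / 2 := by
    have h1 : Tendsto (fun C : ℝ => (C / 2) ^ (-q)) atTop (𝓝 0) :=
      (tendsto_rpow_neg_atTop hq0).comp (tendsto_id.atTop_div_const two_pos)
    have h2 : Tendsto (fun C : ℝ => 2 * C ^ (q - 2)) atTop (𝓝 0) := by
      simpa using (tendsto_rpow_neg_atTop h2q).const_mul 2
    have hω2 : 0 < ω / 2 := by positivity
    exact ((eventually_gt_atTop 0).and ((h1.eventually_lt_const hω2).and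
      (h2.eventually_lt_const hω2))).exists
  refine ⟨C * (2 / q) ^ γ, γ, by positivity, hγ0, fun Ω hΩ hpos _ w hw => ?_⟩
  have hzero : (∀ᵐ x ∂volume.restrict Ω, w x = 0) → eLpNorm w ⊤ (volume.restrict Ω) < ⊤ ∧
      eLpNorm w ⊤ (volume.restrict Ω) ≤
        ENNReal.ofReal (C * (2 / q) ^ γ) * lambda1 N s q Ω ^ (-γ) := fun h => by
    rw [eLpNorm_congr_ae (show w =ᵐ[volume.restrict Ω] 0 from h), eLpNorm_zero]
    exact ⟨ENNReal.zero_lt_top, zero_le⟩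
  rcases Ω.eq_empty_or_nonempty with rfl | hne
  · exact hzero (by simp)
  have hwint := hw.integrableOn_rpow hN hs hq hΩ hne
  have hnn : 0 ≤ᵐ[volume.restrict Ω] fun x => w x ^ q :=
    (ae_restrict_of_ae hw.2.1).mono fun x hx => Real.rpow_nonneg hx q
  rcases (integral_nonneg_of_ae hnn).eq_or_lt with hM | hM
  · refine hzero ?_
    filter_upwards [(integral_eq_zero_iff_of_nonneg_ae hnn hwint).1 hM.symm,
      ae_restrict_of_ae hw.2.1] with x hx hx0
    exact ((Real.rpow_eq_zero_iff_of_nonneg hx0).1 hx).1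
  have hlam := hw.lambda1_mul_le hq0 hM
  set M := ∫ x in Ω, w x ^ q with hMdef
  have hle : ∀ᵐ x ∂volume, w x ≤ C * M ^ β := by
    refine hw.ae_le hN hs0 hq hΩ.measurableSet hwint (R := M ^ θ) (by positivity)
      (by positivity) ?_ ?_
    · rw [← hMdef, ← hω, ← Real.rpow_natCast, ← Real.rpow_mul hM.le, mul_div_right_comm,
        div_eq_mul_inv, ← Real.rpow_neg (by positivity), Real.mul_rpow (by positivity)
        (by positivity), ← Real.rpow_mul hM.le, mul_left_comm, ← Real.rpow_one_add' hM.le]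
      · have : 1 + β * -q = θ * N := by
          rw [hβ, hθ]; field_simp; simp only [D]; ring
        rw [this]
        gcongr
      · have : 1 + β * -q = θ * N := by
          rw [hβ, hθ]; field_simp; simp only [D]; ring
        rw [this]
        have : (0 : ℝ) < N := by exact_mod_cast hN
        positivity
    · rw [← hω, ← Real.rpow_mul hM.le, Real.mul_rpow hC0.le (by positivity),
        ← Real.rpow_mul hM.le, ← mul_assoc]
      have : β * (q - 2) = θ * -(2 * s) := by rw [hβ, hθ]; ring
      rw [this]
      gcongr
  have hnorm : eLpNorm w ⊤ (volume.restrict Ω) ≤ ENNReal.ofReal (C * M ^ β) := by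
    rw [eLpNorm_exponent_top]
    refine eLpNormEssSup_le_of_ae_bound ?_
    filter_upwards [ae_restrict_of_ae hle, ae_restrict_of_ae hw.2.1] with x hx hx0
    rwa [Real.norm_of_nonneg hx0]
  refine ⟨hnorm.trans_lt ENNReal.ofReal_lt_top, hnorm.trans ?_⟩
  have hpow : M ^ β = (2 / q) ^ γ * (2 / q * M ^ (-((2 - q) / q))) ^ (-γ) := by
    rw [Real.mul_rpow (by positivity) (by positivity), ← mul_assoc,
      ← Real.rpow_add (by positivity), add_neg_cancel, Real.rpow_zero, one_mul,
      ← Real.rpow_mul hM.le]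
    congr 1
    rw [hγ]; field_simp
  rw [hpow, ← mul_assoc, ENNReal.ofReal_mul (by positivity),
    ← ENNReal.ofReal_rpow_of_pos (by positivity)]
  refine mul_le_mul' le_rfl ?_
  rw [ENNReal.rpow_neg, ENNReal.rpow_neg]
  exact ENNReal.inv_le_inv.2 (ENNReal.rpow_le_rpow hlam hγ0.le)
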